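/- arXiv:1003.0096 — 4 statements merged into one kernel-verified Lean document; each statement's English description precedes it below -/
import Mathlib

section
/- Let D be a category with a zero object, zero morphisms and binary coproducts, let E be an abelian category, and let F : D ⥤ E be a functor that preserves regular epimorphisms. Fix an object A of D. For any regular epimorphism f : X → Y in D, the induced morphism on second cross-effects cr₂F(A,X) → cr₂F(A,Y) (the morphism between the kernels of F(A ⨿ X) → F(A) × F(X) and of F(A ⨿ Y) → F(A) × F(Y) induced by F(𝟙_A ⨿ f)) is an epimorphism. -/
open CategoryTheory CategoryTheory.Limits

section Aux
variable {D E : Type*} [Category D] [Category E]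
    [HasZeroMorphisms D] [HasBinaryCoproducts D] [Abelian E] (F : D ⥤ E)

/-- The idempotent projecting onto the cross-effect. -/
noncomputable def crAuxE (A X : D) : F.obj (A ⨿ X) ⟶ F.obj (A ⨿ X) :=
  𝟙 _ - F.map (coprod.desc (𝟙 A) 0 ≫ coprod.inl) - F.map (coprod.desc 0 (𝟙 X) ≫ coprod.inr)
    + F.map 0

lemma crAuxE_comp (A X : D) : crAuxE F A X ≫
    prod.lift (F.map (coprod.desc (𝟙 A) 0)) (F.map (coprod.desc 0 (𝟙 X))) = 0 := by
  apply Limits.prod.hom_ext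
  · simp only [crAuxE, Category.assoc, prod.lift_fst, Preadditive.add_comp, Preadditive.sub_comp,
      ← F.map_comp, Category.id_comp, coprod.inl_desc, coprod.inr_desc, Category.comp_id,
      comp_zero, zero_comp]
    abel
  · simp only [crAuxE, Category.assoc, prod.lift_snd, Preadditive.add_comp, Preadditive.sub_comp,
      ← F.map_comp, Category.id_comp, coprod.inl_desc, coprod.inr_desc, Category.comp_id,
      comp_zero, zero_comp]
    abel

lemma crAuxE_ker (A X : D) {K : E} (k : K ⟶ F.obj (A ⨿ X))
    (h : k ≫ prod.lift (F.map (coprod.desc (𝟙 A) 0)) (F.map (coprod.desc 0 (𝟙 X))) = 0) :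
    k ≫ crAuxE F A X = k := by
  have h1 : k ≫ F.map (coprod.desc (𝟙 A) 0) = 0 := by
    have := h =≫ Limits.prod.fst
    rwa [Category.assoc, prod.lift_fst, zero_comp] at this
  have h2 : k ≫ F.map (coprod.desc 0 (𝟙 X)) = 0 := by
    have := h =≫ Limits.prod.snd
    rwa [Category.assoc, prod.lift_snd, zero_comp] at this
  have h3 : k ≫ F.map (0 : A ⨿ X ⟶ A ⨿ X) = 0 := by
    rw [← comp_zero (f := coprod.desc (𝟙 A) (0 : X ⟶ A)), F.map_comp, reassoc_of% h1, zero_comp]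
  simp only [crAuxE, Preadditive.comp_add, Preadditive.comp_sub, F.map_comp, reassoc_of% h1,
    reassoc_of% h2, h3, zero_comp, Category.comp_id, sub_zero, add_zero]

lemma crAuxE_nat (A : D) {X Y : D} (f : X ⟶ Y) :
    F.map (coprod.map (𝟙 A) f) ≫ crAuxE F A Y = crAuxE F A X ≫ F.map (coprod.map (𝟙 A) f) := by
  have h1 : coprod.map (𝟙 A) f ≫ coprod.desc (𝟙 A) 0 ≫ coprod.inl =
      (coprod.desc (𝟙 A) 0 ≫ coprod.inl) ≫ coprod.map (𝟙 A) f := by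
    ext <;> simp
  have h2 : coprod.map (𝟙 A) f ≫ coprod.desc 0 (𝟙 Y) ≫ coprod.inr =
      (coprod.desc 0 (𝟙 X) ≫ coprod.inr) ≫ coprod.map (𝟙 A) f := by
    ext <;> simp
  simp only [crAuxE, Preadditive.comp_add, Preadditive.comp_sub, Preadditive.add_comp,
    Preadditive.sub_comp, ← F.map_comp, h1, h2, Category.comp_id, Category.id_comp,
    comp_zero, zero_comp]

/-- `A ⨿ -` preserves regular epimorphisms. -/
noncomputable def crAuxReg (A : D) {X Y : D} (f : X ⟶ Y) (hf : RegularEpi f) :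
    RegularEpi (coprod.map (𝟙 A) f) where
  W := A ⨿ hf.W
  left := coprod.map (𝟙 A) hf.left
  right := coprod.map (𝟙 A) hf.right
  w := by simp [hf.w]
  isColimit := Cofork.IsColimit.mk' _ fun s => by
    have hs : hf.left ≫ coprod.inr ≫ s.π = hf.right ≫ coprod.inr ≫ s.π := by
      simpa using coprod.inr ≫= s.condition
    have hd := Cofork.IsColimit.π_desc' hf.isColimit (coprod.inr ≫ s.π) hs
    refine ⟨coprod.desc (coprod.inl ≫ s.π)
      (Cofork.IsColimit.desc hf.isColimit (coprod.inr ≫ s.π) hs), ?_, ?_⟩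
    · change coprod.map (𝟙 A) f ≫ _ = s.π
      change f ≫ _ = _ at hd
      apply coprod.hom_ext
      · rw [coprod.inl_map_assoc, Category.id_comp, coprod.inl_desc]
      · rw [coprod.inr_map_assoc, coprod.inr_desc, hd]
    · intro m hm
      change coprod.map (𝟙 A) f ≫ m = s.π at hm
      apply coprod.hom_ext
      · rw [coprod.inl_desc, ← hm, coprod.inl_map_assoc, Category.id_comp]
      · apply Cofork.IsColimit.hom_ext hf.isColimit
        rw [coprod.inr_desc, hd, ← hm, coprod.inr_map_assoc]
        rfl

end Aux

/-- If `F : D ⥤ E` preserves regular epimorphisms, `E` abelian, then for a regular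
epimorphism `f : X ⟶ Y` in `D`, the induced morphism on second cross-effects
`cr₂F(A,X) ⟶ cr₂F(A,Y)` (induced by `F(𝟙_A ⨿ f)`) is an epimorphism. -/
theorem crossEffect2_map_epi {D E : Type*} [Category D] [Category E]
    [HasZeroObject D] [HasZeroMorphisms D] [HasBinaryCoproducts D]
    [Abelian E]
    (F : D ⥤ E)
    (hF : ∀ ⦃X Y : D⦄ (f : X ⟶ Y), RegularEpi f → RegularEpi (F.map f))
    (A : D) {X Y : D} (f : X ⟶ Y) (hf : RegularEpi f)
    (w : prod.lift (F.map (coprod.desc (𝟙 A) 0)) (F.map (coprod.desc 0 (𝟙 X))) ≫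
          prod.map (𝟙 (F.obj A)) (F.map f) =
        F.map (coprod.map (𝟙 A) f) ≫
          prod.lift (F.map (coprod.desc (𝟙 A) 0)) (F.map (coprod.desc 0 (𝟙 Y)))) :
    Epi (kernel.map
      (prod.lift (F.map (coprod.desc (𝟙 A) 0)) (F.map (coprod.desc 0 (𝟙 X))))
      (prod.lift (F.map (coprod.desc (𝟙 A) 0)) (F.map (coprod.desc 0 (𝟙 Y))))
      (F.map (coprod.map (𝟙 A) f)) (prod.map (𝟙 (F.obj A)) (F.map f)) w) := by
  have := (hF _ (crAuxReg A f hf)).epi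
  have hid : kernel.ι (prod.lift (F.map (coprod.desc (𝟙 A) 0)) (F.map (coprod.desc 0 (𝟙 Y)))) ≫
      kernel.lift _ (crAuxE F A Y) (crAuxE_comp F A Y) = 𝟙 _ := by
    rw [← cancel_mono (kernel.ι _), Category.assoc, kernel.lift_ι, Category.id_comp]
    exact crAuxE_ker F A Y _ (kernel.condition _)
  have : IsSplitEpi (kernel.lift _ (crAuxE F A Y) (crAuxE_comp F A Y)) := ⟨⟨⟨_, hid⟩⟩⟩
  refine epi_of_epi_fac (f := kernel.lift _ (crAuxE F A X) (crAuxE_comp F A X))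
    (h := F.map (coprod.map (𝟙 A) f) ≫ kernel.lift _ (crAuxE F A Y) (crAuxE_comp F A Y)) ?_
  rw [← cancel_mono (kernel.ι _)]
  simp only [Category.assoc, kernel.map, kernel.lift_ι, kernel.lift_ι_assoc]
  exact (crAuxE_nat F A f).symm
end

section
/- For groups A and G, let K be the kernel of the canonical homomorphism b : A ∗ G →* A × G, let ψ : K →* A be any group homomorphism, and let N be the normal closure in A ∗ G of the set { x * (inl (ψ x))⁻¹ : x ∈ K }. Then: (1) N is contained in the kernel of the retraction r_G : A ∗ G →* G (r_G ∘ inl trivial, r_G ∘ inr = id), so r_G induces a homomorphism p : (A ∗ G)/N →* G; (2) the composite of the quotient map q : A ∗ G →* (A ∗ G)/N with inr is a section of p, i.e. p(q(inr g)) = g for all g; (3) the kernel of p equals the image of A under q ∘ inl, i.e. the sequence A → (A ∗ G)/N → G is exact. -/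
open Monoid Coprod

variable (A G : Type*) [Group A] [Group G]

/-- The retraction `r_G : A ∗ G →* G` (trivial on `A`, identity on `G`). -/
noncomputable def retrG : A ∗ G →* G := Coprod.lift 1 (MonoidHom.id G)

variable {A G}

/-- For `ψ : ker(toProd) →* A`, the normal closure of `{ x * (inl (ψ x))⁻¹ }`. -/
noncomputable def relN (ψ : MonoidHom.ker (Coprod.toProd : A ∗ G →* A × G) →* A) :
    Subgroup (A ∗ G) :=
  Subgroup.normalClosure
    { y : A ∗ G | ∃ x : MonoidHom.ker (Coprod.toProd : A ∗ G →* A × G),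
        y = (x : A ∗ G) * (Coprod.inl (ψ x))⁻¹ }

instance relN_normal (ψ : MonoidHom.ker (Coprod.toProd : A ∗ G →* A × G) →* A) :
    (relN ψ).Normal :=
  Subgroup.normalClosure_normal

/-- (1) `N ≤ ker r_G`, so `r_G` induces `p : (A ∗ G)/N →* G`; (2) `p ∘ q ∘ inr = id`,
so `q ∘ inr` is a section of `p`; (3) `ker p` is the image of `A` under `q ∘ inl`,
i.e. the sequence `A → (A ∗ G)/N → G` is exact. -/
theorem quotient_splitting (ψ : MonoidHom.ker (Coprod.toProd : A ∗ G →* A × G) →* A) :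
    ∃ hN : ∀ y ∈ relN ψ, retrG A G y = 1,
      (∀ g : G, QuotientGroup.lift (relN ψ) (retrG A G) hN
          (QuotientGroup.mk' (relN ψ) (Coprod.inr g)) = g) ∧
      MonoidHom.ker (QuotientGroup.lift (relN ψ) (retrG A G) hN) =
        MonoidHom.range ((QuotientGroup.mk' (relN ψ)).comp
          (Coprod.inl : A →* A ∗ G)) := by
  have hs : ∀ y : A ∗ G, retrG A G y = (Coprod.toProd y).2 := fun y =>
    (Coprod.snd_toProd y).symm
  have hl : ∀ a : A, retrG A G (Coprod.inl a) = 1 := fun a => rfl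
  have hN : ∀ y ∈ relN ψ, retrG A G y = 1 := by
    have h : relN ψ ≤ (retrG A G).ker := by
      apply Subgroup.normalClosure_le_normal
      rintro _ ⟨x, rfl⟩
      have hx : Coprod.toProd (x : A ∗ G) = 1 := x.2
      change retrG A G _ = 1
      rw [map_mul, map_inv, hl, hs, hx]
      simp
    exact fun y hy => h hy
  refine ⟨hN, fun g => rfl, ?_⟩
  ext z
  constructor
  · obtain ⟨y, rfl⟩ := QuotientGroup.mk'_surjective _ z
    intro hy
    have hy1 : retrG A G y = 1 := hy
    have hx : y * (Coprod.inl (Coprod.fst y))⁻¹ ∈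
        MonoidHom.ker (Coprod.toProd : A ∗ G →* A × G) := by
      rw [MonoidHom.mem_ker, map_mul, map_inv, Coprod.toProd_apply_inl]
      rw [hs] at hy1
      ext
      · simp
      · simp [hy1]
    have hr : (y * (Coprod.inl (Coprod.fst y))⁻¹) * (Coprod.inl (ψ ⟨_, hx⟩))⁻¹ ∈ relN ψ :=
      Subgroup.subset_normalClosure ⟨⟨_, hx⟩, rfl⟩
    have hq : QuotientGroup.mk' (relN ψ) ((y * (Coprod.inl (Coprod.fst y))⁻¹) *
        (Coprod.inl (ψ ⟨_, hx⟩))⁻¹) = 1 := (QuotientGroup.eq_one_iff _).2 hr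
    refine ⟨ψ ⟨_, hx⟩ * Coprod.fst y, ?_⟩
    rw [map_mul, map_mul, map_inv, map_inv, mul_inv_eq_one, mul_inv_eq_iff_eq_mul] at hq
    rw [hq, map_mul]
    rfl
  · rintro ⟨a, rfl⟩
    exact hl a
end

section
/- For groups A and G, let K be the kernel of the canonical homomorphism b : A ∗ G →* A × G, let ψ : K →* A be a group homomorphism, let N be the normal closure in A ∗ G of { x * (inl (ψ x))⁻¹ : x ∈ K }, and let q : A ∗ G →* (A ∗ G)/N be the quotient map. Let C be a group and f_A : A →* C, f_G : G →* C homomorphisms such that for all x ∈ K one has f_A (ψ x) = ⟨f_A, f_G⟩(x), where ⟨f_A, f_G⟩ : A ∗ G →* C is the homomorphism with ⟨f_A,f_G⟩ ∘ inl = f_A and ⟨f_A,f_G⟩ ∘ inr = f_G. Then there exists a unique homomorphism f : (A ∗ G)/N →* C such that f(q(inl a)) = f_A a for all a ∈ A and f(q(inr g)) = f_G g for all g ∈ G. -/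
open Monoid Coprod

variable {A G : Type*} [Group A] [Group G]

/-- Universal property of the quotient `Q_ψ = (A ∗ G)/N`: given `f_A : A →* C` and
`f_G : G →* C` with `f_A ∘ ψ = ⟨f_A, f_G⟩` on `ker toProd`, there is a unique
`f : (A ∗ G)/N →* C` with `f ∘ q ∘ inl = f_A` and `f ∘ q ∘ inr = f_G`. -/
theorem quotient_universal_property
    (ψ : MonoidHom.ker (Coprod.toProd : A ∗ G →* A × G) →* A)
    {C : Type*} [Group C] (fA : A →* C) (fG : G →* C)
    (hcomp : ∀ x : MonoidHom.ker (Coprod.toProd : A ∗ G →* A × G),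
      fA (ψ x) = Coprod.lift fA fG (x : A ∗ G)) :
    ∃! f : (A ∗ G) ⧸ relN ψ →* C,
      (∀ a : A, f (QuotientGroup.mk' (relN ψ) (Coprod.inl a)) = fA a) ∧
      (∀ g : G, f (QuotientGroup.mk' (relN ψ) (Coprod.inr g)) = fG g) := by
  have hle : relN ψ ≤ (Coprod.lift fA fG).ker := by
    apply Subgroup.normalClosure_le_normal
    rintro y ⟨x, rfl⟩
    rw [SetLike.mem_coe, MonoidHom.mem_ker, map_mul, map_inv, Coprod.lift_apply_inl, hcomp x,
      mul_inv_cancel]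
  refine ⟨QuotientGroup.lift (relN ψ) (Coprod.lift fA fG) hle, ⟨fun a => ?_, fun g => ?_⟩, ?_⟩
  · exact Coprod.lift_apply_inl fA fG a
  · exact Coprod.lift_apply_inr fA fG g
  · rintro f ⟨h1, h2⟩
    apply QuotientGroup.monoidHom_ext
    apply Coprod.hom_ext
    · ext a
      exact (h1 a).trans (Coprod.lift_apply_inl fA fG a).symm
    · ext g
      exact (h2 g).trans (Coprod.lift_apply_inr fA fG g).symm
end

section
/- Let A be a group and X₁, X₂ subgroups of A. Let b : X₁ ∗ X₂ →* X₁ × X₂ be the canonical homomorphism and let c : X₁ ∗ X₂ →* A be the homomorphism determined by the inclusions X₁ ↪ A and X₂ ↪ A. Then the image under c of the kernel of b equals the commutator subgroup ⁅X₁, X₂⁆ of A (the subgroup generated by all commutators ⁅x₁, x₂⁆ with x₁ ∈ X₁, x₂ ∈ X₂). (This identifies the categorical commutator [X₁, X₂], defined as the image of the second cross-effect (X₁|X₂) under the folding map, with the usual commutator subgroup in the category of groups.) -/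
open Monoid Coprod

/-- For subgroups `X₁, X₂` of `A`, the image in `A` of the kernel of the canonical
map `X₁ ∗ X₂ →* X₁ × X₂` under the homomorphism induced by the inclusions equals
the commutator subgroup `⁅X₁, X₂⁆`. -/
theorem map_ker_toProd_eq_commutator {A : Type*} [Group A] (X₁ X₂ : Subgroup A) :
    Subgroup.map
      (Coprod.lift X₁.subtype X₂.subtype : ↥X₁ ∗ ↥X₂ →* A)
      (MonoidHom.ker (Coprod.toProd : ↥X₁ ∗ ↥X₂ →* ↥X₁ × ↥X₂)) =
    ⁅X₁, X₂⁆ := by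
  apply le_antisymm
  · have key : ∀ w : ↥X₁ ∗ ↥X₂,
        (Coprod.lift X₁.subtype X₂.subtype w : A) *
          (((Coprod.toProd w).1 : A) * ((Coprod.toProd w).2 : A))⁻¹ ∈ ⁅X₁, X₂⁆ := by
      intro w
      induction w using Coprod.induction_on' with
      | one => simp
      | inl_mul m x ih =>
        have h := (Subgroup.mem_normalizer_iff.1
          (Subgroup.normalizer_commutator_ge_left X₁ X₂ m.2) _).1 ih
        convert h using 1
        simp [mul_assoc]
      | inr_mul n x ih =>
        have h := (Subgroup.mem_normalizer_iff.1
          (Subgroup.normalizer_commutator_ge_right X₁ X₂ n.2) _).1 ih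
        open scoped commutatorElement in
        have h2 : ⁅(n : A), ((Coprod.toProd x).1 : A)⁆ ∈ ⁅X₁, X₂⁆ := by
          rw [Subgroup.commutator_comm]
          exact Subgroup.commutator_mem_commutator n.2 (Coprod.toProd x).1.2
        convert mul_mem h h2 using 1
        simp [mul_assoc, commutatorElement_def]
    rintro _ ⟨w, hw, rfl⟩
    have h := key w
    have hw' : Coprod.toProd w = 1 := hw
    rw [hw'] at h
    simpa using h
  · rw [Subgroup.commutator_le]
    intro a ha b hb
    open scoped commutatorElement in
    refine ⟨⁅(Coprod.inl ⟨a, ha⟩ : ↥X₁ ∗ ↥X₂), (Coprod.inr ⟨b, hb⟩ : ↥X₁ ∗ ↥X₂)⁆, ?_, ?_⟩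
    · simp [MonoidHom.mem_ker, commutatorElement_def]
    · simp [commutatorElement_def]
end
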